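/- Single-letterization of conditional entropy for product channels: for a cq-state on X^n Y^n where Y^n = Y_1 ⊗ ... ⊗ Y_n and conditionally on X^n = x^n the state of Y^n is W_{x_1} ⊗ ... ⊗ W_{x_n}, it holds that H(X^n | Y^n) ≤ Σ_{i=1}^n H(X|Y)_{P_{X_i}} ≤ n · H(X|Y)_{(1/n)Σ_i P_{X_i}}. -/

import Mathlib

open Matrix Finset
open scoped Kronecker ComplexOrder

/-- A density operator: positive semidefinite with unit trace. -/
def IsDensity {m : Type*} [Fintype m] [DecidableEq m] (ρ : Matrix m m ℂ) : Prop :=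
  ρ.PosSemidef ∧ ρ.trace = 1

/-- A probability distribution on a finite type. -/
def IsDist {X : Type*} [Fintype X] (P : X → ℝ) : Prop :=
  (∀ x, 0 ≤ P x) ∧ ∑ x, P x = 1

/-- von Neumann entropy (base 2) of a Hermitian matrix, via its eigenvalues. -/
noncomputable def vNEntropy {m : Type*} [Fintype m] [DecidableEq m]
    (ρ : Matrix m m ℂ) : ℝ :=
  if h : ρ.IsHermitian then ∑ i, -(h.eigenvalues i * Real.logb 2 (h.eigenvalues i)) else 0

/-- The classical-quantum state `Σ_x P(x) |x⟩⟨x| ⊗ W_x`. -/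
noncomputable def cqState {X : Type*} [Fintype X] [DecidableEq X] {m : Type*}
    [Fintype m] [DecidableEq m] (P : X → ℝ) (W : X → Matrix m m ℂ) :
    Matrix (X × m) (X × m) ℂ :=
  fun p q => if p.1 = q.1 then (P p.1 : ℂ) * W p.1 p.2 q.2 else 0

/-- Conditional entropy `H(X|Y)_P = H(XY) - H(Y)` of the cq-state `Σ_x P(x)|x⟩⟨x| ⊗ W_x`. -/
noncomputable def condEntropy {X : Type*} [Fintype X] [DecidableEq X] {m : Type*}
    [Fintype m] [DecidableEq m] (P : X → ℝ) (W : X → Matrix m m ℂ) : ℝ :=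
  vNEntropy (cqState P W) - vNEntropy (∑ x, (P x : ℂ) • W x)

/-- Trace norm of a Hermitian matrix (sum of absolute values of eigenvalues). -/
noncomputable def traceNorm {m : Type*} [Fintype m] [DecidableEq m]
    (A : Matrix m m ℂ) : ℝ :=
  if h : A.IsHermitian then ∑ i, |h.eigenvalues i| else 0

/-- `n`-fold tensor product of a family of matrices. -/
noncomputable def tensorPow {n d : ℕ} (A : Fin n → Matrix (Fin d) (Fin d) ℂ) :
    Matrix (Fin n → Fin d) (Fin n → Fin d) ℂ :=
  fun f g => ∏ i, A i (f i) (g i)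

/-- `Ξ^{(n)}_{x^n} := Σ_i I ⊗ ... ⊗ Ξ_{x_i} ⊗ ... ⊗ I`. -/
noncomputable def siteSum {n d : ℕ} (A : Fin n → Matrix (Fin d) (Fin d) ℂ) :
    Matrix (Fin n → Fin d) (Fin n → Fin d) ℂ :=
  ∑ i, (fun f g => A i (f i) (g i) * ∏ j ∈ univ.erase i, (if f j = g j then (1:ℂ) else 0))

/-- Spectral projection `{A ≥ c}` of a Hermitian matrix. -/
noncomputable def specProj {m : Type*} [Fintype m] [DecidableEq m]
    (A : Matrix m m ℂ) (c : ℝ) : Matrix m m ℂ :=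
  if h : A.IsHermitian then
    (h.eigenvectorUnitary : Matrix m m ℂ) *
      Matrix.diagonal (fun i => if c ≤ h.eigenvalues i then (1:ℂ) else 0) *
      (h.eigenvectorUnitary : Matrix m m ℂ)ᴴ
  else 0

/-- Hermitian functional calculus power `A^r` (real power of eigenvalues). -/
noncomputable def mpow {m : Type*} [Fintype m] [DecidableEq m]
    (A : Matrix m m ℂ) (r : ℝ) : Matrix m m ℂ :=
  if h : A.IsHermitian then
    (h.eigenvectorUnitary : Matrix m m ℂ) *
      Matrix.diagonal (fun i => ((h.eigenvalues i ^ r : ℝ) : ℂ)) *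
      (h.eigenvectorUnitary : Matrix m m ℂ)ᴴ
  else 0

/-- Sandwiched Rényi relative entropy of order `α` (base 2). -/
noncomputable def sandwichedRenyi {m : Type*} [Fintype m] [DecidableEq m]
    (α : ℝ) (ρ σ : Matrix m m ℂ) : ℝ :=
  (α - 1)⁻¹ *
    Real.logb 2
      ((mpow (mpow σ (-(α - 1) / (2 * α)) * ρ * mpow σ (-(α - 1) / (2 * α))) α).trace.re)

section Spectral

variable {m : Type*} [Fintype m] [DecidableEq m]

theorem vNEntropy_eq_of_diagonalization {U A : Matrix m m ℂ} {a : m → ℝ} (hU : Uᴴ * U = 1)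
    (hA : A = U * diagonal (fun i => (a i : ℂ)) * Uᴴ) :
    vNEntropy A = (∑ i, Real.negMulLog (a i)) / Real.log 2 := by
  have h : A.IsHermitian := by
    rw [hA]
    refine isHermitian_mul_mul_conjTranspose _ ?_
    exact isHermitian_diagonal_of_self_adjoint _ (by ext i; simp)
  have hchar : A.charpoly = (diagonal (fun i => (a i : ℂ))).charpoly := by
    rw [hA, charpoly_mul_comm, ← Matrix.mul_assoc, hU, Matrix.one_mul]
  have hroots := h.roots_charpoly_eq_eigenvalues
  rw [hchar, charpoly_diagonal, Polynomial.roots_prod _ _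
    (by simp [Finset.prod_ne_zero_iff, Polynomial.X_sub_C_ne_zero])] at hroots
  simp only [Polynomial.roots_X_sub_C, Multiset.bind_singleton] at hroots
  have hsum := congrArg (fun s => (s.map fun z : ℂ => Real.negMulLog z.re).sum) hroots
  simp only [Multiset.map_map, Function.comp_def, Complex.coe_algebraMap, Complex.ofReal_re] at hsum
  change ∑ i, Real.negMulLog (a i) = ∑ i, Real.negMulLog (h.eigenvalues i) at hsum
  rw [vNEntropy, dif_pos h, hsum, Finset.sum_div]
  refine Finset.sum_congr rfl fun i _ => ?_
  rw [Real.negMulLog, Real.logb]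
  ring

theorem Matrix.IsHermitian.exists_diagonalization {A : Matrix m m ℂ} (h : A.IsHermitian) :
    ∃ (U : Matrix m m ℂ) (a : m → ℝ), Uᴴ * U = 1 ∧
      A = U * diagonal (fun i => (a i : ℂ)) * Uᴴ := by
  refine ⟨h.eigenvectorUnitary, h.eigenvalues, ?_, ?_⟩
  · exact Unitary.coe_star_mul_self h.eigenvectorUnitary
  · conv_lhs => rw [h.spectral_theorem, Unitary.conjStarAlgAut_apply]
    rfl

theorem conj_eq_diagonal_of_diagonalization {U A : Matrix m m ℂ} {a : m → ℝ} (hU : Uᴴ * U = 1)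
    (hA : A = U * diagonal (fun i => (a i : ℂ)) * Uᴴ) :
    Uᴴ * A * U = diagonal fun i => (a i : ℂ) := by
  calc _ = (Uᴴ * U) * diagonal (fun i => (a i : ℂ)) * (Uᴴ * U) := by
        rw [hA]; simp only [Matrix.mul_assoc]
    _ = _ := by simp [hU]

theorem re_conj_sum_smul_diag {X : Type*} [Fintype X] (P : X → ℝ) (W : X → Matrix m m ℂ)
    (V : Matrix m m ℂ) (k : m) :
    ((Vᴴ * (∑ x, (P x : ℂ) • W x) * V) k k).re = ∑ x, P x * ((Vᴴ * W x * V) k k).re := by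
  simp [Matrix.mul_sum, Matrix.sum_mul, Matrix.sum_apply]

end Spectral

section LogComparison

open Filter Topology

theorem hasDerivAt_mul_log_add_mul {a b T : ℝ} (ha : 0 ≤ a) (hb : 0 ≤ b) (hT : 0 ≤ T) :
    HasDerivAt (fun T => a * Real.log (a + T * b)) (a * b / (a + T * b)) T := by
  rcases ha.eq_or_lt with rfl | ha
  · simpa using hasDerivAt_const T (0 : ℝ)
  · have h : HasDerivAt (fun T => a + T * b) b T := by
      simpa using ((hasDerivAt_id T).mul_const b).const_add a
    have hpos : a + T * b ≠ 0 := by positivity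
    simpa [mul_div_assoc] using (h.log hpos).const_mul a

theorem tendsto_mul_log_add_mul_sub {c a b : ℝ} (hb : 0 ≤ b) (h0 : b = 0 → c * a = 0) :
    Tendsto (fun T => c * (a * Real.log (a + T * b)) - c * a * Real.log T) atTop
      (𝓝 (c * a * Real.log b)) := by
  rcases hb.eq_or_lt with rfl | hb
  · simp [← mul_assoc, h0 rfl]
  · have h1 : Tendsto (fun T : ℝ => a / T + b) atTop (𝓝 b) := by
      simpa using (tendsto_const_nhds.div_atTop tendsto_id : Tendsto (fun T : ℝ => a / T) atTop
        (𝓝 0)).add_const b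
    have h2 := (h1.log hb.ne').const_mul (c * a)
    refine h2.congr' ?_
    filter_upwards [h1.eventually_ne hb.ne', eventually_gt_atTop 0] with T hT hT0
    have : a + T * b = T * (a / T + b) := by field_simp
    rw [this, Real.log_mul hT0.ne' hT]
    ring

/-- Integrating `∑ p q / (p + T q) ≤ ∑ c a b / (a + T b)` over `T ∈ (0, ∞)`. -/
theorem sum_mul_log_sub_le_of_parallel_sum_le {J K : Type*} [Fintype J] [Fintype K]
    {p q : J → ℝ} {c a b : K → ℝ} (hp : ∀ j, 0 ≤ p j) (hq : ∀ j, 0 ≤ q j)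
    (hpq : ∀ j, q j = 0 → p j = 0) (ha : ∀ k, 0 ≤ a k) (hb : ∀ k, 0 ≤ b k)
    (hab : ∀ k, b k = 0 → c k * a k = 0) (hsum : ∑ k, c k * a k = ∑ j, p j)
    (hle : ∀ T : ℝ, 0 < T →
      ∑ j, p j * q j / (p j + T * q j) ≤ ∑ k, c k * (a k * b k / (a k + T * b k))) :
    ∑ k, c k * a k * Real.log (a k) - ∑ k, c k * a k * Real.log (b k) ≤
      ∑ j, p j * Real.log (p j) - ∑ j, p j * Real.log (q j) := by
  set Δ : ℝ → ℝ := fun T => ∑ k, c k * (a k * Real.log (a k + T * b k)) -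
    ∑ j, p j * Real.log (p j + T * q j) with hΔ
  have hderiv : ∀ T : ℝ, 0 ≤ T → HasDerivAt Δ
      (∑ k, c k * (a k * b k / (a k + T * b k)) - ∑ j, p j * q j / (p j + T * q j)) T :=
    fun T hT => (HasDerivAt.fun_sum fun k _ =>
      (hasDerivAt_mul_log_add_mul (ha k) (hb k) hT).const_mul (c k)).sub
      (HasDerivAt.fun_sum fun j _ => hasDerivAt_mul_log_add_mul (hp j) (hq j) hT)
  have hmono : MonotoneOn Δ (Set.Ici 0) := by
    refine monotoneOn_of_deriv_nonneg (convex_Ici 0)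
      (fun T hT => (hderiv T hT).continuousAt.continuousWithinAt) ?_ ?_
    · intro T hT
      rw [interior_Ici] at hT
      exact (hderiv T (le_of_lt hT)).differentiableAt.differentiableWithinAt
    · intro T hT
      rw [interior_Ici] at hT
      rw [(hderiv T (le_of_lt hT)).deriv, sub_nonneg]
      exact hle T hT
  have hlim : Tendsto Δ atTop
      (𝓝 (∑ k, c k * a k * Real.log (b k) - ∑ j, p j * Real.log (q j))) := by
    have h1 := tendsto_finsetSum (univ : Finset K) fun k _ =>
      tendsto_mul_log_add_mul_sub (hb k) (hab k)
    have h2 := tendsto_finsetSum (univ : Finset J) fun j _ =>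
      tendsto_mul_log_add_mul_sub (c := 1) (a := p j) (hq j) (by simpa using hpq j)
    simp only [one_mul] at h2
    refine (h1.sub h2).congr fun T => ?_
    simp only [Finset.sum_sub_distrib, ← Finset.sum_mul, hsum, hΔ]
    ring
  have h0 : Δ 0 ≤ _ := ge_of_tendsto hlim <| by
    filter_upwards [eventually_ge_atTop 0] with T hT
    exact hmono (Set.mem_Ici.2 le_rfl) hT hT
  simp only [hΔ, zero_mul, add_zero, ← mul_assoc] at h0
  linarith

end LogComparison

theorem re_trace_conj_diagonal {m : Type*} [Fintype m] [DecidableEq m] {U V B : Matrix m m ℂ}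
    {a : m → ℝ} (hU : Uᴴ * U = 1) (hV : Vᴴ * V = 1) :
    ((U * B * Vᴴ)ᴴ * (U * diagonal (fun i => (a i : ℂ)) * Uᴴ) * (U * B * Vᴴ)).trace.re =
      ∑ i, ∑ k, Complex.normSq (B i k) * a i := by
  have h : (U * B * Vᴴ)ᴴ * (U * diagonal (fun i => (a i : ℂ)) * Uᴴ) * (U * B * Vᴴ) =
      V * (Bᴴ * (Uᴴ * U) * diagonal (fun i => (a i : ℂ)) * (Uᴴ * U) * B) * Vᴴ := by
    simp only [conjTranspose_mul, conjTranspose_conjTranspose, Matrix.mul_assoc]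
  rw [h, trace_mul_comm, ← Matrix.mul_assoc, hV, Matrix.one_mul, hU, Matrix.mul_one,
    Matrix.mul_one, trace, Complex.re_sum, Finset.sum_comm]
  refine Finset.sum_congr rfl fun k _ => ?_
  rw [diag_apply, Matrix.mul_apply, Complex.re_sum]
  refine Finset.sum_congr rfl fun i _ => ?_
  simp [Complex.normSq_apply]
  ring

section RelativeEntropy

variable {m J : Type*} [Fintype m] [DecidableEq m] [Fintype J]

theorem re_trace_mul_mul_conjTranspose_ge {A : Matrix m m ℂ} (hA : A.PosSemidef)
    (Y : Matrix m m ℂ) (s : ℝ) :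
    2 * s * (A * Y).trace.re - s ^ 2 * A.trace.re ≤ (Y * A * Yᴴ).trace.re := by
  have h := (Complex.nonneg_iff.1
    (hA.mul_mul_conjTranspose_same (Y - (s : ℂ) • (1 : Matrix m m ℂ))).trace_nonneg).1
  have hconj : (A * Yᴴ).trace = star (A * Y).trace := by
    rw [← trace_conjTranspose, conjTranspose_mul, hA.1.eq, trace_mul_comm]
  have hexp : (Y - (s : ℂ) • (1 : Matrix m m ℂ)) * A * (Y - (s : ℂ) • (1 : Matrix m m ℂ))ᴴ =
      Y * A * Yᴴ - (s : ℂ) • (Y * A) - (s : ℂ) • (A * Yᴴ) + ((s : ℂ) * s) • A := by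
    simp only [conjTranspose_sub, conjTranspose_smul, conjTranspose_one, Matrix.sub_mul,
      Matrix.mul_sub, smul_mul_assoc, mul_smul_comm, Matrix.one_mul, Matrix.mul_one, smul_smul,
      smul_sub]
    simp
    abel
  rw [hexp] at h
  simp only [trace_add, trace_sub, trace_smul, hconj, trace_mul_comm Y A, Complex.add_re,
    Complex.sub_re, smul_eq_mul, Complex.mul_re, Complex.ofReal_re, Complex.ofReal_im, zero_mul,
    sub_zero, Complex.star_def, Complex.conj_re, Complex.mul_im, add_zero, mul_zero] at h
  linarith

theorem parallel_sum_mul_trace_le {A : Matrix m m ℂ} (hA : A.PosSemidef) (X : Matrix m m ℂ)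
    {α β : ℝ} (hα : 0 ≤ α) (hβ : 0 ≤ β) :
    α * β / (α + β) * A.trace.re ≤
      α * (Xᴴ * A * X).trace.re + β * ((1 - X) * A * (1 - X)ᴴ).trace.re := by
  have h1 := re_trace_mul_mul_conjTranspose_ge hA Xᴴ (β / (α + β))
  have h2 := re_trace_mul_mul_conjTranspose_ge hA (1 - X) (α / (α + β))
  rw [conjTranspose_conjTranspose] at h1
  have hconj : (A * Xᴴ).trace.re = (A * X).trace.re := by
    have : (A * Xᴴ).trace = star (A * X).trace := by
      rw [← trace_conjTranspose, conjTranspose_mul, hA.1.eq, trace_mul_comm]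
    simp [this]
  rw [hconj] at h1
  rw [Matrix.mul_sub, Matrix.mul_one, trace_sub, Complex.sub_re] at h2
  refine le_trans (le_of_eq ?_)
    (add_le_add (mul_le_mul_of_nonneg_left h1 hα) (mul_le_mul_of_nonneg_left h2 hβ))
  rcases (add_nonneg hα hβ).eq_or_lt with h0 | h0
  · simp [← h0]
  · field_simp
    ring

/-- The relative entropy of two states in `{∑ p_j A_j}` is at most that of the weights; the
eigenbasis `V` of the second state is arbitrary. -/
theorem relEntropy_le_of_preparation {A : J → Matrix m m ℂ} (hA : ∀ j, IsDensity (A j))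
    {p q : J → ℝ} (hp : ∀ j, 0 ≤ p j) (hq : ∀ j, 0 ≤ q j) (hpq : ∀ j, q j = 0 → p j = 0)
    {V : Matrix m m ℂ} {b : m → ℝ} (hV : Vᴴ * V = 1)
    (hσ : ∑ j, (q j : ℂ) • A j = V * diagonal (fun k => (b k : ℂ)) * Vᴴ) :
    -(vNEntropy (∑ j, (p j : ℂ) • A j) * Real.log 2) -
        ∑ k, (∑ j, p j * ((Vᴴ * A j * V) k k).re) * Real.log (b k) ≤
      ∑ j, p j * Real.log (p j) - ∑ j, p j * Real.log (q j) := by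
  have hpsd : ∀ r : J → ℝ, (∀ j, 0 ≤ r j) → (∑ j, (r j : ℂ) • A j).PosSemidef := fun r hr =>
    posSemidef_sum _ fun j _ => (hA j).1.smul (by exact_mod_cast hr j)
  obtain ⟨U, a, hU, hρ⟩ := (hpsd p hp).1.exists_diagonalization
  have hV' : V * Vᴴ = 1 := mul_eq_one_comm.1 hV
  have hU' : U * Uᴴ = 1 := mul_eq_one_comm.1 hU
  have hnn : ∀ {r : J → ℝ} {Q : Matrix m m ℂ} {e : m → ℝ}, (∀ j, 0 ≤ r j) → Qᴴ * Q = 1 →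
      ∑ j, (r j : ℂ) • A j = Q * diagonal (fun k => (e k : ℂ)) * Qᴴ → ∀ k, 0 ≤ e k := by
    intro r Q e hr hQ h k
    have := ((hpsd r hr).conjTranspose_mul_mul_same Q).diag_nonneg (i := k)
    rw [conj_eq_diagonal_of_diagonalization hQ h, diagonal_apply_eq] at this
    exact_mod_cast this
  have ha := hnn hp hU hρ
  have hb := hnn hq hV hσ
  set C := Uᴴ * V with hC
  have hCC : Cᴴ * C = 1 := by
    rw [hC, conjTranspose_mul, conjTranspose_conjTranspose, Matrix.mul_assoc,
      ← Matrix.mul_assoc U, hU', Matrix.one_mul, hV]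
  have hCC' : C * Cᴴ = 1 := mul_eq_one_comm.1 hCC
  have hrow : ∀ i, ∑ k, Complex.normSq (C i k) = 1 := by
    intro i
    have := congrArg Complex.re (congrFun (congrFun hCC' i) i)
    simpa [Matrix.mul_apply, Complex.mul_conj] using this
  have hw : ∀ k, ∑ j, p j * ((Vᴴ * A j * V) k k).re =
      ∑ i, Complex.normSq (C i k) * a i := by
    intro k
    have : Vᴴ * (∑ j, (p j : ℂ) • A j) * V = Cᴴ * diagonal (fun i => (a i : ℂ)) * C := by
      rw [hρ, hC, conjTranspose_mul, conjTranspose_conjTranspose]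
      simp only [Matrix.mul_assoc]
    rw [← re_conj_sum_smul_diag, this, Matrix.mul_apply]
    simp only [mul_diagonal, conjTranspose_apply, Complex.re_sum]
    refine Finset.sum_congr rfl fun i _ => ?_
    simp [Complex.normSq_apply]
    ring
  have hgnn : ∀ j k, 0 ≤ ((Vᴴ * A j * V) k k).re := fun j k =>
    (Complex.nonneg_iff.1 ((hA j).1.conjTranspose_mul_mul_same V).diag_nonneg).1
  have hbk : ∀ k, ∑ j, q j * ((Vᴴ * A j * V) k k).re = b k := by
    intro k
    rw [← re_conj_sum_smul_diag, conj_eq_diagonal_of_diagonalization hV hσ]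
    simp
  have hsupp : ∀ i k, b k = 0 → Complex.normSq (C i k) * a i = 0 := by
    intro i k h
    have h1 := hbk k
    rw [h, Finset.sum_eq_zero_iff_of_nonneg fun j _ => mul_nonneg (hq j) (hgnn j k)] at h1
    have h2 : ∑ i, Complex.normSq (C i k) * a i = 0 := by
      rw [← hw]
      refine Finset.sum_eq_zero fun j hj => ?_
      rcases mul_eq_zero.1 (h1 j hj) with h | h
      · simp [hpq j h]
      · simp [h]
    exact (Finset.sum_eq_zero_iff_of_nonneg fun i _ =>
      mul_nonneg (Complex.normSq_nonneg _) (ha i)).1 h2 i (Finset.mem_univ i)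
  have htr : ∑ i, a i = ∑ j, p j := by
    have h1 := congrArg Complex.re (congrArg trace (conj_eq_diagonal_of_diagonalization hU hρ).symm)
    rw [trace_mul_comm, ← Matrix.mul_assoc, hU', Matrix.one_mul] at h1
    simpa [trace_diagonal, trace_sum, (hA _).2] using h1
  have hkey := sum_mul_log_sub_le_of_parallel_sum_le (K := m × m)
    (c := fun x => Complex.normSq (C x.1 x.2)) (a := fun x => a x.1) (b := fun x => b x.2)
    hp hq hpq (fun x => ha x.1) (fun x => hb x.2) (fun x => hsupp x.1 x.2)
    (by simp only [Fintype.sum_prod_type, ← Finset.sum_mul, hrow, one_mul, htr]) (by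
      intro T hT
      set y : Matrix m m ℝ := fun i k => T * b k / (a i + T * b k) with hy
      set X : Matrix m m ℂ := U * (of fun i k => (y i k : ℂ) * C i k) * Vᴴ with hX
      have hX1 : 1 - X = (V * (of fun i k => ((1 - y i k : ℝ) : ℂ) * C i k)ᴴ * Uᴴ)ᴴ := by
        have h1 : (1 : Matrix m m ℂ) = U * C * Vᴴ := by
          rw [hC, ← Matrix.mul_assoc, hU', Matrix.one_mul, hV']
        have h2 : (of fun i k => ((1 - y i k : ℝ) : ℂ) * C i k) =
            C - of fun i k => (y i k : ℂ) * C i k := by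
          ext i k
          simp [sub_mul]
        rw [h2, conjTranspose_mul, conjTranspose_mul, conjTranspose_conjTranspose,
          conjTranspose_conjTranspose, ← Matrix.mul_assoc, Matrix.mul_sub, Matrix.sub_mul, ← h1, hX]
      have hXρ : (Xᴴ * (∑ j, (p j : ℂ) • A j) * X).trace.re =
          ∑ i, ∑ k, Complex.normSq (y i k * C i k) * a i := by
        rw [hρ, hX, re_trace_conj_diagonal hU hV]
        simp only [of_apply]
      have hXσ : ((1 - X) * (∑ j, (q j : ℂ) • A j) * (1 - X)ᴴ).trace.re =
          ∑ i, ∑ k, Complex.normSq ((1 - y i k : ℝ) * C i k) * b k := by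
        have h1 := re_trace_conj_diagonal (a := b) (B := (of fun i k =>
          ((1 - y i k : ℝ) : ℂ) * C i k)ᴴ) hV hU
        rw [hX1, hσ, conjTranspose_conjTranspose, h1, Finset.sum_comm]
        simp only [conjTranspose_apply, of_apply, Complex.star_def, Complex.normSq_conj]
      have hlin : ∑ j, (p j / T * (Xᴴ * A j * X).trace.re +
          q j * ((1 - X) * A j * (1 - X)ᴴ).trace.re) =
          (Xᴴ * (∑ j, (p j : ℂ) • A j) * X).trace.re / T +
          ((1 - X) * (∑ j, (q j : ℂ) • A j) * (1 - X)ᴴ).trace.re := by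
        simp only [Matrix.mul_sum, Matrix.sum_mul, trace_sum, Complex.re_sum, Finset.sum_div,
          Finset.sum_add_distrib, mul_smul_comm, smul_mul_assoc, trace_smul, smul_eq_mul,
          Complex.re_ofReal_mul, div_mul_eq_mul_div]
      calc ∑ j, p j * q j / (p j + T * q j)
          ≤ ∑ j, (p j / T * (Xᴴ * A j * X).trace.re +
              q j * ((1 - X) * A j * (1 - X)ᴴ).trace.re) := by
            refine Finset.sum_le_sum fun j _ => ?_
            refine le_trans (le_of_eq ?_)
              (parallel_sum_mul_trace_le (hA j).1 X (div_nonneg (hp j) hT.le) (hq j))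
            rw [(hA j).2, Complex.one_re, mul_one]
            field_simp
        _ = ∑ x : m × m, Complex.normSq (C x.1 x.2) *
              (a x.1 * b x.2 / (a x.1 + T * b x.2)) := by
            rw [hlin, hXρ, hXσ, Fintype.sum_prod_type]
            simp only [Finset.sum_div, ← Finset.sum_add_distrib]
            refine Finset.sum_congr rfl fun i _ => Finset.sum_congr rfl fun k _ => ?_
            rw [Complex.normSq_mul, Complex.normSq_mul, Complex.normSq_ofReal,
              Complex.normSq_ofReal, hy]
            have hTb := mul_nonneg hT.le (hb k)
            rcases (add_nonneg (ha i) hTb).eq_or_lt with h0 | h0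
            · have hai : a i = 0 := by linarith [ha i]
              have hbk0 : b k = 0 := by
                have : T * b k = 0 := by linarith [ha i]
                exact (mul_eq_zero.1 this).resolve_left hT.ne'
              simp [hai, hbk0]
            · field_simp
              ring)
  simp only [Fintype.sum_prod_type] at hkey
  rw [vNEntropy_eq_of_diagonalization hU hρ, div_mul_cancel₀ _ (by positivity)]
  refine le_trans (le_of_eq ?_) hkey
  congr 1
  · rw [← Finset.sum_neg_distrib]
    refine Finset.sum_congr rfl fun i _ => ?_
    rw [← Finset.sum_mul, ← Finset.sum_mul, hrow, Real.negMulLog]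
    ring
  · rw [Finset.sum_comm]
    refine Finset.sum_congr rfl fun k _ => ?_
    rw [hw, Finset.sum_mul]

end RelativeEntropy

section Marginals

variable {ι K : Type*} [Fintype ι] [DecidableEq ι] [Fintype K] [DecidableEq K]

theorem sum_filter_prod_eq {g : ι → K → ℝ} (hg : ∀ j, ∑ k, g j k = 1) (i : ι) (k : K) :
    ∑ f : ι → K with f i = k, ∏ j, g j (f j) = g i k := by
  have h : (univ.filter fun f : ι → K => f i = k) =
      Fintype.piFinset fun j => if j = i then {k} else univ := by
    ext f
    simp only [mem_filter, mem_univ, true_and, Fintype.mem_piFinset]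
    refine ⟨fun h j => ?_, fun h => by simpa using h i⟩
    split_ifs with hj
    · simp [hj, h]
    · simp
  rw [h, ← Finset.prod_univ_sum, Finset.prod_eq_single i]
  · simp
  · intro j _ hj
    simp [hj, hg]
  · simp

theorem sum_mul_apply_eq {w : (ι → K) → ℝ} {b : ι → K → ℝ}
    (hb : ∀ i k, b i k = ∑ f : ι → K with f i = k, w f) (i : ι) (φ : K → ℝ) :
    ∑ f, w f * φ (f i) = ∑ k, b i k * φ k := by
  rw [← Finset.sum_fiberwise univ (fun f : ι → K => f i)]
  refine Finset.sum_congr rfl fun k _ => ?_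
  rw [hb, Finset.sum_mul]
  refine Finset.sum_congr rfl fun f hf => ?_
  rw [(mem_filter.1 hf).2]

theorem eq_zero_of_prod_marginal_eq_zero {w : (ι → K) → ℝ} (hw : ∀ f, 0 ≤ w f) {b : ι → K → ℝ}
    (hb : ∀ i k, b i k = ∑ f : ι → K with f i = k, w f) {f : ι → K}
    (hf : ∏ i, b i (f i) = 0) : w f = 0 := by
  obtain ⟨i, _, hi⟩ := Finset.prod_eq_zero_iff.1 hf
  rw [hb, Finset.sum_eq_zero_iff_of_nonneg fun f _ => hw f] at hi
  exact hi f (by simp)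

theorem sum_mul_log_prod_marginal {w : (ι → K) → ℝ} (hw : ∀ f, 0 ≤ w f) {b : ι → K → ℝ}
    (hb : ∀ i k, b i k = ∑ f : ι → K with f i = k, w f) :
    ∑ f, w f * Real.log (∏ i, b i (f i)) = ∑ i, ∑ k, b i k * Real.log (b i k) := by
  have h : ∀ f, w f * Real.log (∏ i, b i (f i)) = ∑ i, w f * Real.log (b i (f i)) := by
    intro f
    by_cases hf : ∏ i, b i (f i) = 0
    · simp [eq_zero_of_prod_marginal_eq_zero hw hb hf]
    · rw [Real.log_prod fun i _ => (Finset.prod_ne_zero_iff.1 hf) i (mem_univ i), Finset.mul_sum]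
  simp only [h]
  rw [Finset.sum_comm]
  exact Finset.sum_congr rfl fun i _ => sum_mul_apply_eq hb i fun k => Real.log (b i k)

end Marginals

section Diagonalization

variable {m : Type*} [Fintype m] [DecidableEq m]

theorem IsDensity.eigenvalue_nonneg {A U : Matrix m m ℂ} {a : m → ℝ} (hA : IsDensity A)
    (hU : Uᴴ * U = 1) (h : A = U * diagonal (fun i => (a i : ℂ)) * Uᴴ) (i : m) : 0 ≤ a i := by
  have h1 := (hA.1.conjTranspose_mul_mul_same U).diag_nonneg (i := i)
  rw [conj_eq_diagonal_of_diagonalization hU h, diagonal_apply_eq] at h1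
  exact_mod_cast h1

theorem IsDensity.sum_eigenvalue {A U : Matrix m m ℂ} {a : m → ℝ} (hA : IsDensity A)
    (hU : Uᴴ * U = 1) (h : A = U * diagonal (fun i => (a i : ℂ)) * Uᴴ) : ∑ i, a i = 1 := by
  have h1 := hA.2
  rw [h, trace_mul_comm, ← Matrix.mul_assoc, hU, Matrix.one_mul, trace_diagonal] at h1
  exact_mod_cast h1

theorem IsDensity.sum_re_conj_diag {A V : Matrix m m ℂ} (hA : IsDensity A) (hV : Vᴴ * V = 1) :
    ∑ k, ((Vᴴ * A * V) k k).re = 1 := by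
  have h1 : (Vᴴ * A * V).trace = 1 := by
    rw [trace_mul_comm, ← Matrix.mul_assoc, mul_eq_one_comm.1 hV, Matrix.one_mul, hA.2]
  have h2 := congrArg Complex.re h1
  rwa [trace, Complex.re_sum] at h2

theorem IsDensity.sum_smul {X : Type*} [Fintype X] {P : X → ℝ} (hP : IsDist P)
    {W : X → Matrix m m ℂ} (hW : ∀ x, IsDensity (W x)) : IsDensity (∑ x, (P x : ℂ) • W x) := by
  refine ⟨posSemidef_sum _ fun x _ => (hW x).1.smul (by exact_mod_cast hP.1 x), ?_⟩
  simp only [trace_sum, trace_smul, (hW _).2, smul_eq_mul, mul_one]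
  exact_mod_cast hP.2

end Diagonalization

section CQState

variable {X m : Type*} [Fintype X] [DecidableEq X] [Fintype m] [DecidableEq m]

theorem cqState_mul (P Q : X → ℝ) (A B : X → Matrix m m ℂ) :
    cqState P A * cqState Q B = cqState (fun x => P x * Q x) fun x => A x * B x := by
  ext ⟨x, i⟩ ⟨y, j⟩
  simp only [Matrix.mul_apply, cqState, Fintype.sum_prod_type, ite_mul, mul_ite, zero_mul,
    mul_zero]
  rw [Finset.sum_eq_single x (fun z _ hz => by simp [hz.symm]) (by simp)]
  by_cases h : x = y
  · subst h
    simp only [if_true, Finset.mul_sum, Complex.ofReal_mul]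
    exact Finset.sum_congr rfl fun k _ => by ring
  · simp [h]

theorem conjTranspose_cqState (P : X → ℝ) (A : X → Matrix m m ℂ) :
    (cqState P A)ᴴ = cqState P fun x => (A x)ᴴ := by
  ext ⟨x, i⟩ ⟨y, j⟩
  by_cases h : x = y
  · subst h
    simp [cqState]
  · simp [cqState, h, Ne.symm h]

theorem vNEntropy_cqState (P : X → ℝ) {W : X → Matrix m m ℂ} (hW : ∀ x, IsDensity (W x)) :
    vNEntropy (cqState P W) * Real.log 2 =
      ∑ x, Real.negMulLog (P x) + ∑ x, P x * (vNEntropy (W x) * Real.log 2) := by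
  choose U a hU ha using fun x => (hW x).1.1.exists_diagonalization
  have h1 : (cqState (fun _ => 1) U)ᴴ * cqState (fun _ => 1) U = 1 := by
    rw [conjTranspose_cqState, cqState_mul]
    ext ⟨x, i⟩ ⟨y, j⟩
    simp only [cqState, hU, Matrix.one_apply, Prod.mk.injEq]
    by_cases h : x = y <;> simp [h]
  have h2 : cqState P W = cqState (fun _ => 1) U *
      diagonal (fun x : X × m => ((P x.1 * a x.1 x.2 : ℝ) : ℂ)) * (cqState (fun _ => 1) U)ᴴ := by
    have h3 : diagonal (fun x : X × m => ((P x.1 * a x.1 x.2 : ℝ) : ℂ)) =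
        cqState P fun x => diagonal fun i => (a x i : ℂ) := by
      ext ⟨x, i⟩ ⟨y, j⟩
      simp only [cqState, diagonal_apply, Prod.mk.injEq]
      by_cases h : x = y <;> by_cases h' : i = j <;> simp [h, h']
    rw [h3, conjTranspose_cqState, cqState_mul, cqState_mul]
    simp only [one_mul, mul_one, ← ha]
  have hlog : Real.log 2 ≠ 0 := by positivity
  rw [vNEntropy_eq_of_diagonalization h1 h2, div_mul_cancel₀ _ hlog, Fintype.sum_prod_type,
    ← Finset.sum_add_distrib]
  refine Finset.sum_congr rfl fun x _ => ?_
  rw [vNEntropy_eq_of_diagonalization (hU x) (ha x), div_mul_cancel₀ _ hlog]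
  simp only [Real.negMulLog_mul, Finset.sum_add_distrib]
  rw [← Finset.sum_mul, (hW x).sum_eigenvalue (hU x) (ha x), one_mul, Finset.mul_sum]

end CQState

section TensorPow

variable {n d : ℕ}

theorem tensorPow_mul (A B : Fin n → Matrix (Fin d) (Fin d) ℂ) :
    tensorPow A * tensorPow B = tensorPow fun i => A i * B i := by
  ext f g
  simp only [Matrix.mul_apply, tensorPow, Finset.prod_univ_sum, Fintype.piFinset_univ,
    Finset.prod_mul_distrib]

theorem conjTranspose_tensorPow (A : Fin n → Matrix (Fin d) (Fin d) ℂ) :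
    (tensorPow A)ᴴ = tensorPow fun i => (A i)ᴴ := by
  ext f g
  simp [tensorPow]

theorem tensorPow_diagonal (a : Fin n → Fin d → ℂ) :
    (tensorPow fun i => diagonal (a i)) = diagonal fun f => ∏ i, a i (f i) := by
  ext f g
  by_cases h : f = g
  · subst h
    simp [tensorPow]
  · obtain ⟨i, hi⟩ := Function.ne_iff.1 h
    rw [diagonal_apply_ne _ h]
    exact Finset.prod_eq_zero (mem_univ i) (diagonal_apply_ne _ hi)

theorem tensorPow_one : (tensorPow fun _ : Fin n => (1 : Matrix (Fin d) (Fin d) ℂ)) = 1 := by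
  simpa using tensorPow_diagonal fun (_ : Fin n) (_ : Fin d) => (1 : ℂ)

theorem tensorPow_isometry {U : Fin n → Matrix (Fin d) (Fin d) ℂ}
    (hU : ∀ i, (U i)ᴴ * U i = 1) : (tensorPow U)ᴴ * tensorPow U = 1 := by
  simp only [conjTranspose_tensorPow, tensorPow_mul, hU, tensorPow_one]

theorem tensorPow_diagonalization {A U : Fin n → Matrix (Fin d) (Fin d) ℂ} {a : Fin n → Fin d → ℝ}
    (h : ∀ i, A i = U i * diagonal (fun k => (a i k : ℂ)) * (U i)ᴴ) :
    tensorPow A = tensorPow U * diagonal (fun f => ((∏ i, a i (f i) : ℝ) : ℂ)) *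
      (tensorPow U)ᴴ := by
  simp only [Complex.ofReal_prod]
  rw [← tensorPow_diagonal fun i k => (a i k : ℂ), conjTranspose_tensorPow, tensorPow_mul,
    tensorPow_mul]
  simp only [← h]

theorem sum_prod_smul_tensorPow {X : Type*} [Fintype X] [DecidableEq X] (P : Fin n → X → ℝ)
    (W : X → Matrix (Fin d) (Fin d) ℂ) :
    ∑ xs : Fin n → X, ((∏ i, P i (xs i) : ℝ) : ℂ) • tensorPow (fun i => W (xs i)) =
      tensorPow fun i => ∑ x, (P i x : ℂ) • W x := by
  ext f g
  simp only [Matrix.sum_apply, Matrix.smul_apply, tensorPow, Finset.prod_univ_sum,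
    Fintype.piFinset_univ, smul_eq_mul, Complex.ofReal_prod, Finset.prod_mul_distrib]

theorem isDensity_tensorPow {A : Fin n → Matrix (Fin d) (Fin d) ℂ} (hA : ∀ i, IsDensity (A i)) :
    IsDensity (tensorPow A) := by
  choose U a hU ha using fun i => (hA i).1.1.exists_diagonalization
  constructor
  · rw [tensorPow_diagonalization ha]
    refine (posSemidef_diagonal_iff.2 fun f => ?_).mul_mul_conjTranspose_same _
    exact_mod_cast Finset.prod_nonneg fun i _ => (hA i).eigenvalue_nonneg (hU i) (ha i) (f i)
  · have : (tensorPow A).trace = ∏ i, (A i).trace := by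
      simp only [trace, diag_apply, Finset.prod_univ_sum, Fintype.piFinset_univ, tensorPow]
    simp [this, (hA _).2]

theorem vNEntropy_tensorPow {A : Fin n → Matrix (Fin d) (Fin d) ℂ} (hA : ∀ i, IsDensity (A i)) :
    vNEntropy (tensorPow A) = ∑ i, vNEntropy (A i) := by
  choose U a hU ha using fun i => (hA i).1.1.exists_diagonalization
  have h := sum_mul_log_prod_marginal (w := fun f => ∏ i, a i (f i)) (b := a)
    (fun f => Finset.prod_nonneg fun i _ => (hA i).eigenvalue_nonneg (hU i) (ha i) (f i))
    fun i k => (sum_filter_prod_eq (fun j => (hA j).sum_eigenvalue (hU j) (ha j)) i k).symm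
  rw [vNEntropy_eq_of_diagonalization (tensorPow_isometry hU) (tensorPow_diagonalization ha)]
  simp only [fun i => vNEntropy_eq_of_diagonalization (hU i) (ha i), ← Finset.sum_div,
    Real.negMulLog, neg_mul, Finset.sum_neg_distrib, h]

end TensorPow

section SingleLetter

variable {X : Type*} [Fintype X] [DecidableEq X]

theorem condEntropy_mul_log_two {m : Type*} [Fintype m] [DecidableEq m] (P : X → ℝ)
    {W : X → Matrix m m ℂ} (hW : ∀ x, IsDensity (W x)) :
    condEntropy P W * Real.log 2 = ∑ x, P x * (vNEntropy (W x) * Real.log 2) -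
      ∑ x, P x * Real.log (P x) - vNEntropy (∑ x, (P x : ℂ) • W x) * Real.log 2 := by
  rw [condEntropy, sub_mul, vNEntropy_cqState P hW]
  simp only [Real.negMulLog, neg_mul, Finset.sum_neg_distrib]
  ring

theorem isDist_marginal {ι : Type*} [Fintype ι] [DecidableEq ι] {P : (ι → X) → ℝ}
    (hP : IsDist P) {Q : ι → X → ℝ}
    (hQ : ∀ i x, Q i x = ∑ xs : ι → X with xs i = x, P xs) (i : ι) : IsDist (Q i) := by
  refine ⟨fun x => hQ i x ▸ Finset.sum_nonneg fun xs _ => hP.1 xs, ?_⟩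
  simp only [hQ, Finset.sum_fiberwise, hP.2]

/-- Conditional entropy is subadditive over memoryless channel uses. -/
theorem condEntropy_tensorPow_le {d n : ℕ} {W : X → Matrix (Fin d) (Fin d) ℂ}
    (hW : ∀ x, IsDensity (W x)) {P : (Fin n → X) → ℝ} (hP : IsDist P) {Q : Fin n → X → ℝ}
    (hQ : ∀ i x, Q i x = ∑ xs : Fin n → X with xs i = x, P xs) :
    condEntropy P (fun xs => tensorPow fun i => W (xs i)) ≤ ∑ i, condEntropy (Q i) W := by
  have hQd := isDist_marginal hP hQ
  have hσ := fun i => IsDensity.sum_smul (hQd i) hW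
  choose V b hV hb using fun i => (hσ i).1.1.exists_diagonalization
  have hWn := fun xs : Fin n → X => isDensity_tensorPow fun i => hW (xs i)
  have hkey := relEntropy_le_of_preparation hWn hP.1
    (q := fun xs => ∏ i, Q i (xs i)) (fun xs => Finset.prod_nonneg fun i _ => (hQd i).1 _)
    (fun xs h => eq_zero_of_prod_marginal_eq_zero hP.1 hQ h) (tensorPow_isometry hV)
    ((sum_prod_smul_tensorPow Q W).trans (tensorPow_diagonalization hb))
  set g : Fin n → X → Fin d → ℝ := fun i x k => (((V i)ᴴ * W x * V i) k k).re with hg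
  have hg0 : ∀ i x k, 0 ≤ g i x k := fun i x k =>
    (Complex.nonneg_iff.1 ((hW x).1.conjTranspose_mul_mul_same (V i)).diag_nonneg).1
  have hgn : ∀ (xs : Fin n → X) f, (((tensorPow V)ᴴ * tensorPow (fun i => W (xs i)) *
      tensorPow V) f f).re = ∏ i, g i (xs i) (f i) := by
    intro xs f
    have hreal : ∀ i, ((V i)ᴴ * W (xs i) * V i) (f i) (f i) = (g i (xs i) (f i) : ℂ) := by
      intro i
      have := ((hW (xs i)).1.conjTranspose_mul_mul_same (V i)).diag_nonneg (i := f i)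
      exact Complex.ext rfl (Complex.nonneg_iff.1 this).2.symm
    rw [conjTranspose_tensorPow, tensorPow_mul, tensorPow_mul, tensorPow]
    simp only [hreal, ← Complex.ofReal_prod, Complex.ofReal_re]
  simp only [hgn] at hkey
  have hbg : ∀ i k, b i k = ∑ x, Q i x * g i x k := by
    intro i k
    rw [← re_conj_sum_smul_diag, conj_eq_diagonal_of_diagonalization (hV i) (hb i)]
    simp
  have hmarg : ∀ i k, b i k = ∑ f : Fin n → Fin d with f i = k,
      ∑ xs, P xs * ∏ j, g j (xs j) (f j) := by
    intro i k
    rw [Finset.sum_comm, hbg, ← sum_mul_apply_eq hQ]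
    refine Finset.sum_congr rfl fun xs _ => ?_
    rw [← Finset.mul_sum, sum_filter_prod_eq (g := fun j k => g j (xs j) k)
      fun j => (hW (xs j)).sum_re_conj_diag (hV j)]
  rw [sum_mul_log_prod_marginal (fun f => Finset.sum_nonneg fun xs _ =>
    mul_nonneg (hP.1 xs) (Finset.prod_nonneg fun i _ => hg0 _ _ _)) hmarg,
    sum_mul_log_prod_marginal hP.1 hQ] at hkey
  have hlog : 0 < Real.log 2 := Real.log_pos one_lt_two
  refine le_of_mul_le_mul_right ?_ hlog
  have hent : ∑ i, vNEntropy (∑ x, (Q i x : ℂ) • W x) * Real.log 2 =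
      -∑ i, ∑ k, b i k * Real.log (b i k) := by
    rw [← Finset.sum_neg_distrib]
    refine Finset.sum_congr rfl fun i _ => ?_
    rw [vNEntropy_eq_of_diagonalization (hV i) (hb i), div_mul_cancel₀ _ hlog.ne']
    simp [Real.negMulLog]
  have hcond : ∑ xs, P xs * (vNEntropy (tensorPow fun i => W (xs i)) * Real.log 2) =
      ∑ i, ∑ x, Q i x * (vNEntropy (W x) * Real.log 2) := by
    simp only [vNEntropy_tensorPow fun i => hW _, Finset.sum_mul, Finset.mul_sum]
    rw [Finset.sum_comm]
    exact Finset.sum_congr rfl fun i _ =>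
      sum_mul_apply_eq hQ i fun x => vNEntropy (W x) * Real.log 2
  rw [Finset.sum_mul, condEntropy_mul_log_two P hWn, hcond]
  simp only [condEntropy_mul_log_two _ hW, Finset.sum_sub_distrib, hent]
  linarith

/-- Concavity of conditional entropy in the input distribution. -/
theorem sum_condEntropy_le {ι m : Type*} [Fintype ι] [Fintype m] [DecidableEq m]
    {W : X → Matrix m m ℂ} (hW : ∀ x, IsDensity (W x)) {Q : ι → X → ℝ}
    (hQ : ∀ i, IsDist (Q i)) {c : ℝ} (hc : 0 < c) (hcard : c = Fintype.card ι) :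
    ∑ i, condEntropy (Q i) W ≤ c * condEntropy (fun x => c⁻¹ * ∑ i, Q i x) W := by
  set R : X → ℝ := fun x => c⁻¹ * ∑ i, Q i x with hR
  have hR0 : ∀ x, 0 ≤ R x := fun x =>
    mul_nonneg (inv_nonneg.2 hc.le) (Finset.sum_nonneg fun i _ => (hQ i).1 x)
  have hsum : ∀ x, ∑ i, Q i x = c * R x := fun x => by
    rw [hR, mul_inv_cancel_left₀ hc.ne']
  have hRd : IsDist R := by
    refine ⟨hR0, ?_⟩
    rw [hR, ← Finset.mul_sum, Finset.sum_comm]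
    simp [(hQ _).2, ← hcard, hc.ne']
  have hsupp : ∀ i x, R x = 0 → Q i x = 0 := fun i x h => by
    have h1 := hsum x
    rw [h, mul_zero, Finset.sum_eq_zero_iff_of_nonneg fun i _ => (hQ i).1 x] at h1
    exact h1 i (mem_univ i)
  obtain ⟨V, b, hV, hb⟩ := (IsDensity.sum_smul hRd hW).1.1.exists_diagonalization
  have hkey := Finset.sum_le_sum fun i (_ : i ∈ univ) =>
    relEntropy_le_of_preparation hW (hQ i).1 hR0 (hsupp i) hV hb
  have hbg : ∀ k, ∑ x, R x * ((Vᴴ * W x * V) k k).re = b k := by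
    intro k
    rw [← re_conj_sum_smul_diag, conj_eq_diagonal_of_diagonalization hV hb]
    simp
  have hlog : 0 < Real.log 2 := Real.log_pos one_lt_two
  have havg : ∀ φ : X → ℝ, ∑ i, ∑ x, Q i x * φ x = c * ∑ x, R x * φ x := by
    intro φ
    rw [Finset.sum_comm, Finset.mul_sum]
    exact Finset.sum_congr rfl fun x _ => by rw [← Finset.sum_mul, hsum, mul_assoc]
  have h1 : ∑ i, ∑ k, (∑ x, Q i x * ((Vᴴ * W x * V) k k).re) * Real.log (b k) =
      -(c * (vNEntropy (∑ x, (R x : ℂ) • W x) * Real.log 2)) := by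
    rw [vNEntropy_eq_of_diagonalization hV hb, div_mul_cancel₀ _ hlog.ne', Finset.sum_comm,
      Finset.mul_sum, ← Finset.sum_neg_distrib]
    refine Finset.sum_congr rfl fun k _ => ?_
    rw [← Finset.sum_mul, havg, hbg, Real.negMulLog]
    ring
  simp only [Finset.sum_sub_distrib, Finset.sum_neg_distrib, h1, havg] at hkey
  refine le_of_mul_le_mul_right ?_ hlog
  rw [Finset.sum_mul, mul_assoc, condEntropy_mul_log_two R hW]
  simp only [condEntropy_mul_log_two _ hW, Finset.sum_sub_distrib, havg]
  linarith

end SingleLetter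

/-- Single-letterization of the conditional entropy for a memoryless cq-channel:
`H(X^n|Y^n) ≤ Σ_i H(X|Y)_{P_{X_i}} ≤ n H(X|Y)_{(1/n)Σ_i P_{X_i}}`. -/
theorem stmt_16 {X : Type*} [Fintype X] [DecidableEq X] {d n : ℕ} (hn : 0 < n)
    (W : X → Matrix (Fin d) (Fin d) ℂ) (hW : ∀ x, IsDensity (W x))
    (Pn : (Fin n → X) → ℝ) (hPn : IsDist Pn)
    (Pm : Fin n → X → ℝ)
    (hPm : ∀ i x, Pm i x =
      ∑ xs ∈ Finset.univ.filter (fun xs : Fin n → X => xs i = x), Pn xs) :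
    condEntropy Pn (fun xs => tensorPow fun i => W (xs i))
        ≤ ∑ i, condEntropy (Pm i) W ∧
      ∑ i, condEntropy (Pm i) W
        ≤ (n : ℝ) * condEntropy (fun x => (n : ℝ)⁻¹ * ∑ i, Pm i x) W := by
  exact ⟨condEntropy_tensorPow_le hW hPn hPm, sum_condEntropy_le hW (isDist_marginal hPn hPm)
    (by exact_mod_cast hn) (by simp)⟩
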